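/- Let δ be a triple derivation on a C*-algebra A and let e ∈ A be a tripotent. Then for all x, y, z ∈ A with P₂(e)(x) = x, P₂(e)(y) = y and P₂(e)(z) = z, one has P₂(e)(δ({x,y,z})) = {P₂(e)(δ(x)), y, z} + {x, P₂(e)(δ(y)), z} + {x, y, P₂(e)(δ(z))}; that is, the compression of δ to the Peirce 2-space A₂(e) is a triple derivation of A₂(e). -/

import Mathlib

variable {A : Type*} [NonUnitalNormedRing A] [StarRing A] [CStarRing A]
  [NormedSpace ℂ A] [IsScalarTower ℂ A A] [SMulCommClass ℂ A A]
  [StarModule ℂ A] [CompleteSpace A]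

/-- The triple product `{x,y,z} = (1/2)(x y* z + z y* x)` on a C*-algebra. -/
noncomputable def tp (x y z : A) : A := (2⁻¹ : ℂ) • (x * star y * z + z * star y * x)

/-- A triple derivation. -/
def IsTripleDerivation (δ : A → A) : Prop :=
  ∀ a b c : A, δ (tp a b c) = tp (δ a) b c + tp a (δ b) c + tp a b (δ c)

/-- The Peirce 2-projection `P₂(e)(x) = e e* x e* e` associated with a tripotent `e`. -/
def P₂ (e x : A) : A := e * star e * x * star e * e

theorem P₂_add (e x y : A) : P₂ e (x + y) = P₂ e x + P₂ e y := by
  simp only [P₂, mul_add, add_mul]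

theorem mul_star_mul_of_P₂_eq_self {e x : A} (he : e * star e * e = e) (hx : P₂ e x = x) :
    e * star e * x = x := by
  rw [← hx, P₂]
  simp only [← mul_assoc, he]

theorem mul_star_mul_self_of_P₂_eq_self {e x : A} (he : e * star e * e = e) (hx : P₂ e x = x) :
    x * (star e * e) = x := by
  rw [mul_assoc] at he
  rw [← hx, P₂]
  simp only [mul_assoc, he]

theorem star_mul_mul_star_of_P₂_eq_self {e x : A} (he : e * star e * e = e) (hx : P₂ e x = x) :
    star x * (e * star e) = star x := by
  simpa only [star_mul, star_star] using congrArg star (mul_star_mul_of_P₂_eq_self he hx)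

theorem star_mul_self_mul_star_of_P₂_eq_self {e x : A} (he : e * star e * e = e)
    (hx : P₂ e x = x) : star e * e * star x = star x := by
  simpa only [star_mul, star_star] using congrArg star (mul_star_mul_self_of_P₂_eq_self he hx)

theorem tp_comm (x y z : A) : tp x y z = tp z y x := by
  rw [tp, tp, add_comm]

theorem P₂_tp_left {e y z : A} (he : e * star e * e = e) (hy : P₂ e y = y) (hz : P₂ e z = z)
    (a : A) : P₂ e (tp a y z) = tp (P₂ e a) y z := by
  have hpz := mul_star_mul_of_P₂_eq_self he hz
  have hzq := mul_star_mul_self_of_P₂_eq_self he hz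
  have hyp := star_mul_mul_star_of_P₂_eq_self he hy
  have hqy := star_mul_self_mul_star_of_P₂_eq_self he hy
  simp only [P₂, tp, mul_smul_comm, smul_mul_assoc, mul_add, add_mul]
  congr 2
  · calc e * star e * (a * star y * z) * star e * e
        = e * star e * a * star y * (z * (star e * e)) := by simp only [mul_assoc]
      _ = e * star e * a * (star e * e * star y) * z := by rw [hzq, hqy]
      _ = _ := by simp only [mul_assoc]
  · calc e * star e * (z * star y * a) * star e * e
        = (e * star e * z) * star y * a * star e * e := by simp only [mul_assoc]
      _ = z * (star y * (e * star e)) * a * star e * e := by rw [hpz, hyp]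
      _ = _ := by simp only [mul_assoc]

theorem P₂_tp_middle {e x z : A} (he : e * star e * e = e) (hx : P₂ e x = x) (hz : P₂ e z = z)
    (a : A) : P₂ e (tp x a z) = tp x (P₂ e a) z := by
  have key {u v : A} (hu : P₂ e u = u) (hv : P₂ e v = v) :
      e * star e * (u * star a * v) * star e * e =
        u * star (e * star e * a * star e * e) * v := by
    have hpu := mul_star_mul_of_P₂_eq_self he hu
    have huq := mul_star_mul_self_of_P₂_eq_self he hu
    have hpv := mul_star_mul_of_P₂_eq_self he hv
    have hvq := mul_star_mul_self_of_P₂_eq_self he hv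
    calc e * star e * (u * star a * v) * star e * e
        = (e * star e * u) * star a * (v * (star e * e)) := by simp only [mul_assoc]
      _ = (u * (star e * e)) * star a * (e * star e * v) := by rw [hpu, hvq, huq, hpv]
      _ = _ := by simp only [mul_assoc, star_mul, star_star]
  simp only [P₂, tp, mul_smul_comm, smul_mul_assoc, mul_add, add_mul]
  rw [key hx hz, key hz hx]

/-- the compression of a triple derivation to the Peirce 2-space of a
tripotent is a triple derivation of the Peirce 2-space. -/
theorem stmt9 (δ : A →ₗ[ℂ] A) (hδ : IsTripleDerivation (δ : A → A))
    (e : A) (he : e * star e * e = e) :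
    ∀ x y z : A, P₂ e x = x → P₂ e y = y → P₂ e z = z →
      P₂ e (δ (tp x y z)) =
        tp (P₂ e (δ x)) y z + tp x (P₂ e (δ y)) z + tp x y (P₂ e (δ z)) := by
  intro x y z hx hy hz
  rw [hδ, P₂_add, P₂_add, P₂_tp_left he hy hz, P₂_tp_middle he hx hz,
    tp_comm x y (δ z), P₂_tp_left he hy hx, tp_comm _ y x]
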